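/- Let a, b ∈ ℂ with b ≠ 0, and let f : ℂ → ℂ be an entire function such that f(z) ≠ a for all z ∈ ℂ and f'(z) ≠ b for all z ∈ ℂ. Then f is constant. -/

import Mathlib

open Metric Real in
/-- Jensen's formula bounds `log ‖k c‖` by the circle average of `log ‖k‖`. -/
lemma log_norm_le_circleAverage_log_norm {k : ℂ → ℂ} {c : ℂ} {r : ℝ} (hr : 0 < r)
    (hk : AnalyticOnNhd ℂ k (closedBall c r)) (hkc : k c ≠ 0) :
    log ‖k c‖ ≤ circleAverage (fun z ↦ log ‖k z‖) c r := by
  rw [← abs_of_pos hr] at hk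
  rw [hk.circleAverage_log_norm hr.ne' hkc]
  refine le_add_of_nonneg_left (finsum_nonneg fun u ↦ ?_)
  by_cases hu : u ∈ closedBall c |r|
  · refine mul_nonneg (mod_cast MeromorphicOn.AnalyticOnNhd.divisor_nonneg hk u) ?_
    rcases eq_or_ne u c with rfl | huc
    · simp
    · have : 0 < ‖c - u‖ := norm_pos_iff.mpr (sub_ne_zero.mpr huc.symm)
      apply log_nonneg
      rw [← div_eq_mul_inv, one_le_div this, ← dist_eq_norm, dist_comm]
      simpa [abs_of_pos hr] using hu
  · simp [hu]

/-- A zero-free entire function is the exponential of an entire function. -/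
lemma exists_differentiable_exp_eq {f : ℂ → ℂ} (hf : Differentiable ℂ f) (h0 : ∀ z, f z ≠ 0) :
    ∃ g : ℂ → ℂ, Differentiable ℂ g ∧ ∀ z, Complex.exp (g z) = f z := by
  have hd : Differentiable ℂ fun z ↦ deriv f z / f z := hf.deriv.div hf h0
  obtain ⟨G, hG⟩ := hd.isExactOn_univ
  have hG' (z : ℂ) : HasDerivAt G (deriv f z / f z) z := hG z (Set.mem_univ z)
  have hconst (z : ℂ) : f z * Complex.exp (-G z) = f 0 * Complex.exp (-G 0) := by
    refine is_const_of_deriv_eq_zero (f := fun z ↦ f z * Complex.exp (-G z)) ?_ (fun x ↦ ?_) z 0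
    · exact fun x ↦ ((hf x).hasDerivAt.mul (hG' x).neg.cexp).differentiableAt
    · refine HasDerivAt.deriv (((hf x).hasDerivAt.mul (hG' x).neg.cexp).congr_deriv ?_)
      field_simp [h0 x]
      ring
  refine ⟨fun z ↦ G z + Complex.log (f 0 * Complex.exp (-G 0)),
    fun z ↦ (hG' z).differentiableAt.add_const _, fun z ↦ ?_⟩
  rw [Complex.exp_add, Complex.exp_log (mul_ne_zero (h0 0) (Complex.exp_ne_zero _)), ← hconst z,
    mul_left_comm, ← Complex.exp_add]
  simp

open Metric Real in
/-- If `exp (-g) * k` and `k` are both bounded by `L` on a circle, the Poisson and Jensen formulas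
bound `-Re g` inside it. -/
lemma neg_re_le_of_exp_neg_mul {g k : ℂ → ℂ} (hg : Differentiable ℂ g) (hk : Differentiable ℂ k)
    (hk0 : k 0 ≠ 0) {r L : ℝ} (hr : 0 < r) (hL : 1 ≤ L)
    (hkL : ∀ z ∈ sphere (0 : ℂ) r, ‖k z‖ ≤ L)
    (hgkL : ∀ z ∈ sphere (0 : ℂ) r, ‖Complex.exp (-g z) * k z‖ ≤ L) {w : ℂ} (hw : ‖w‖ < r) :
    -(g w).re ≤ (r + ‖w‖) / (r - ‖w‖) * (log L - log ‖k 0‖) := by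
  have hwb : w ∈ ball (0 : ℂ) r := by simpa using hw
  have hrw : 0 < r - ‖w‖ := sub_pos.mpr hw
  have hka : AnalyticOnNhd ℂ k Set.univ := fun z _ ↦ hk.analyticAt z
  have log_le {u : ℂ} (hu : ‖u‖ ≤ L) : log ‖u‖ ≤ log L := by
    rcases eq_or_ne u 0 with rfl | h
    · simpa using log_nonneg hL
    · exact log_le_log (norm_pos_iff.mpr h) hu
  have hharm : InnerProductSpace.HarmonicOnNhd (fun z ↦ (-g z).re) (closedBall (0 : ℂ) r) :=
    fun z _ ↦ (hg.neg.analyticAt z).harmonicAt_re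
  have hP := hharm.circleAverage_re_herglotzRieszKernel_smul hwb
  set P : ℂ → ℝ := Complex.re ∘ herglotzRieszKernel 0 w with hPdef
  have hPc : ContinuousOn P (sphere (0 : ℂ) |r|) :=
    Complex.continuous_re.comp_continuousOn (continuousOn_herglotzRieszKernel_sphere hwb)
  have hlogk : CircleIntegrable (fun z ↦ log ‖k z‖) 0 r :=
    MeromorphicOn.circleIntegrable_log_norm fun z _ ↦ (hk.analyticAt z).meromorphicAt
  have hlogB : CircleIntegrable (fun z ↦ log ‖Complex.exp (-g z) * k z‖) 0 r :=
    MeromorphicOn.circleIntegrable_log_norm fun z _ ↦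
      ((hg.neg.cexp.mul hk).analyticAt z).meromorphicAt
  have hcongr : circleAverage (P • fun z ↦ (-g z).re) 0 r = circleAverage
      (P • fun z ↦ log ‖Complex.exp (-g z) * k z‖ - log ‖k z‖) 0 r := by
    refine circleAverage_congr_codiscreteWithin ?_ hr.ne'
    filter_upwards [Filter.codiscreteWithin_mono (Set.subset_univ _)
      (hka.preimage_zero_mem_codiscrete hk0)] with z hz
    have hz' : ‖k z‖ ≠ 0 := norm_ne_zero_iff.mpr hz
    simp only [Pi.smul_apply', norm_mul, Complex.norm_exp]
    rw [log_mul (exp_pos _).ne' hz', log_exp, add_sub_cancel_right]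
  have hconst : CircleIntegrable (fun _ : ℂ ↦ log L) 0 r := circleIntegrable_const _ _ _
  calc -(g w).re = circleAverage (P • fun z ↦ (-g z).re) 0 r := by rw [hP]; simp
    _ = circleAverage (P • fun z ↦ log ‖Complex.exp (-g z) * k z‖ - log ‖k z‖) 0 r := hcongr
    _ ≤ circleAverage (((r + ‖w‖) / (r - ‖w‖)) • fun z ↦ log L - log ‖k z‖) 0 r := by
      refine circleAverage_mono ((hlogB.sub hlogk).continuousOn_smul hPc)
        ((hconst.sub hlogk).const_smul) fun z hz ↦ ?_
      rw [abs_of_pos hr] at hz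
      have h1 : P z ≤ (r + ‖w‖) / (r - ‖w‖) := by
        simpa [hPdef, herglotzRieszKernel_def] using re_herglotzRieszKernel_le hz hwb
      have h0 : 0 ≤ P z := by
        have h := le_re_herglotzRieszKernel hz hwb
        have : 0 ≤ (r - ‖w‖) / (r + ‖w‖) := by positivity
        simp only [sub_zero] at h
        simpa [hPdef, herglotzRieszKernel_def] using this.trans h
      have h2 := log_le (hgkL z hz)
      have h3 := log_le (hkL z hz)
      simp only [Pi.smul_apply', Pi.smul_apply, smul_eq_mul]
      exact (mul_le_mul_of_nonneg_left (by linarith) h0).trans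
        (mul_le_mul_of_nonneg_right h1 (by linarith))
    _ = (r + ‖w‖) / (r - ‖w‖) * (log L - circleAverage (fun z ↦ log ‖k z‖) 0 r) := by
      rw [circleAverage_smul, circleAverage_fun_sub hconst hlogk, circleAverage_const, smul_eq_mul]
    _ ≤ _ := by
      gcongr
      exact log_norm_le_circleAverage_log_norm hr (hka.mono (Set.subset_univ _)) hk0

/-- Cauchy's estimate for the derivative of an entire function on a smaller disc. -/
lemma norm_deriv_le_of_norm_le {f : ℂ → ℂ} (hf : Differentiable ℂ f) {ρ s C : ℝ} (hs : 0 < s)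
    (hC : ∀ w, ‖w‖ ≤ ρ + s → ‖f w‖ ≤ C) {z : ℂ} (hz : ‖z‖ ≤ ρ) : ‖deriv f z‖ ≤ C / s := by
  refine Complex.norm_deriv_le_of_forall_mem_sphere_norm_le hs hf.diffContOnCl fun w hw ↦ hC w ?_
  have h : ‖w - z‖ = s := by simpa using hw
  linarith [norm_le_norm_add_norm_sub' w z]

open Metric in
/-- A simplified form of the Borel–Carathéodory theorem. -/
lemma norm_le_of_re_le {f : ℂ → ℂ} (hf : Differentiable ℂ f) {ρ s R N : ℝ} (hs : 0 < s)
    (hR : ρ + s ≤ R) (hN : 0 < N) (hfN : ∀ w, ‖w‖ ≤ ρ + s → (f w).re ≤ N) {z : ℂ}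
    (hz : ‖z‖ ≤ ρ) : ‖f z‖ ≤ (2 * N + 2 * ‖f 0‖) * R / s := by
  have hz0 := norm_nonneg z
  have h := Complex.borelCaratheodory (R := ρ + s) (z := z) hN hf.differentiableOn
    (fun w hw ↦ hfN w (by simpa using (mem_ball_zero_iff.mp hw).le)) (by linarith)
    (by simpa using by linarith)
  calc ‖f z‖ ≤ _ := h
    _ ≤ 2 * N * R / s + ‖f 0‖ * (2 * R) / s := by
      have hR0 : 0 ≤ R := by linarith
      gcongr <;> linarith
    _ = _ := by ring

/-- If `g' * exp g - 1 = exp h`, then `exp (-g) * h'` is a polynomial in derivatives of `g`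
and `h`. -/
lemma exp_neg_mul_deriv_eq {g h : ℂ → ℂ} (hg : Differentiable ℂ g) (hh : Differentiable ℂ h)
    (hgh : ∀ z, deriv g z * Complex.exp (g z) - 1 = Complex.exp (h z)) (z : ℂ) :
    Complex.exp (-g z) * deriv h z =
      deriv h z * deriv g z - deriv (deriv g) z - deriv g z ^ 2 := by
  have h1 : HasDerivAt (fun z ↦ deriv g z * Complex.exp (g z) - 1)
      (deriv (deriv g) z * Complex.exp (g z) +
        deriv g z * (Complex.exp (g z) * deriv g z)) z :=
    ((hg.deriv z).hasDerivAt.mul (hg z).hasDerivAt.cexp).sub_const 1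
  have h2 : HasDerivAt (fun z ↦ Complex.exp (h z)) (Complex.exp (h z) * deriv h z) z :=
    (hh z).hasDerivAt.cexp
  have h3 := (funext hgh ▸ h1).unique h2
  rw [← hgh z] at h3
  rw [Complex.exp_neg, inv_mul_eq_div, div_eq_iff (Complex.exp_ne_zero _)]
  linear_combination h3

/-- An a priori estimate: a bound for `g` on a disc improves itself on smaller discs. -/
lemma exists_norm_pow_four_le {g h : ℂ → ℂ} (hg : Differentiable ℂ g) (hh : Differentiable ℂ h)
    (hgh : ∀ z, deriv g z * Complex.exp (g z) - 1 = Complex.exp (h z)) (hh0 : deriv h 0 ≠ 0) :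
    ∃ C : ℝ, 0 ≤ C ∧ ∀ R d M : ℝ, 1 ≤ R → 0 < d → d ≤ R → 1 ≤ M →
      (∀ w, ‖w‖ ≤ R → ‖g w‖ ≤ M) →
      ∀ z, ‖z‖ ≤ R - d → ‖g z‖ ^ 4 ≤ C * (R / d) ^ 9 * (M * R) := by
  set c : ℝ := 70 + 10 * ‖h 0‖ with hc
  set K : ℝ := Real.log (25 * c + 50) - Real.log ‖deriv h 0‖ with hK
  have hc0 : 70 ≤ c := by linarith [norm_nonneg (h 0)]
  refine ⟨(100 * (16 + |K|) + 10 * ‖g 0‖) ^ 4, by positivity, fun R d M hR hd hdR hM hgM z hz ↦ ?_⟩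
  set s : ℝ := d / 5 with hs
  have hs0 : 0 < s := by positivity
  have hR0 : 0 < R := by linarith
  have hRd : 1 ≤ R / d := (one_le_div hd).mpr hdR
  set Y : ℝ := M * R * (R / d) with hY
  have hMR : 1 ≤ M * R := one_le_mul_of_one_le_of_one_le hM hR
  have hY1 : 1 ≤ Y := one_le_mul_of_one_le_of_one_le hMR hRd
  have hRdY : R / d ≤ Y := le_mul_of_one_le_left (by positivity) hMR
  have hMdY : M / d ≤ Y := by
    rw [hY, mul_assoc, div_eq_mul_inv, div_eq_mul_inv]
    gcongr
    nlinarith [inv_pos.mpr hd, mul_pos hR0 (inv_pos.mpr hd),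
      mul_le_mul_of_nonneg_right hR (inv_pos.mpr hd).le]
  have hdY : 1 / d ≤ Y := (by gcongr : 1 / d ≤ M / d).trans hMdY
  have hMY : M ≤ Y := (le_mul_of_one_le_right (by positivity) hR).trans
    (le_mul_of_one_le_right (by positivity) hRd)
  have hA (w : ℂ) (hw : ‖w‖ ≤ R - s) : ‖deriv g w‖ ≤ 5 * Y := by
    refine (norm_deriv_le_of_norm_le hg hs0 (fun u hu ↦ hgM u (by linarith)) hw).trans ?_
    calc M / s = 5 * (M / d) := by rw [hs]; field_simp
      _ ≤ 5 * Y := by gcongr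
  have hhre (w : ℂ) (hw : ‖w‖ ≤ R - s) : (h w).re ≤ 7 * Y := by
    rw [← Real.exp_le_exp, ← Complex.norm_exp, ← hgh w]
    have h1 : ‖Complex.exp (g w)‖ ≤ Real.exp M := by
      rw [Complex.norm_exp, Real.exp_le_exp]
      exact (Complex.re_le_norm _).trans (hgM w (by linarith))
    calc ‖deriv g w * Complex.exp (g w) - 1‖ ≤ ‖deriv g w‖ * ‖Complex.exp (g w)‖ + 1 := by
          simpa using norm_sub_le (deriv g w * Complex.exp (g w)) 1
      _ ≤ 5 * Y * Real.exp M + 1 * Real.exp M := by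
          gcongr
          · exact hA w hw
          · linarith [Real.one_le_exp (by linarith : 0 ≤ M)]
      _ = (5 * Y + 1) * Real.exp M := by ring
      _ ≤ Real.exp (6 * Y) * Real.exp Y := by
          gcongr
          linarith [Real.add_one_le_exp (6 * Y)]
      _ = Real.exp (7 * Y) := by rw [← Real.exp_add]; ring_nf
  have hhn (w : ℂ) (hw : ‖w‖ ≤ R - 2 * s) : ‖h w‖ ≤ c * Y ^ 2 := by
    refine (norm_le_of_re_le hh hs0 (R := R) (by linarith) (by positivity : 0 < 7 * Y)
      (fun u hu ↦ hhre u (by linarith)) hw).trans ?_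
    calc (2 * (7 * Y) + 2 * ‖h 0‖) * R / s = (14 * Y + 2 * ‖h 0‖ * 1) * 5 * (R / d) := by
          rw [hs]; field_simp; ring
      _ ≤ (14 * Y + 2 * ‖h 0‖ * Y) * 5 * Y := by gcongr
      _ = c * Y ^ 2 := by rw [hc]; ring
  have hh' (w : ℂ) (hw : ‖w‖ ≤ R - 3 * s) : ‖deriv h w‖ ≤ 5 * c * Y ^ 3 := by
    refine (norm_deriv_le_of_norm_le hh hs0 (fun u hu ↦ hhn u (by linarith)) hw).trans ?_
    calc c * Y ^ 2 / s = 5 * c * Y ^ 2 * (1 / d) := by rw [hs]; field_simp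
      _ ≤ 5 * c * Y ^ 2 * Y := by gcongr
      _ = _ := by ring
  have hA' (w : ℂ) (hw : ‖w‖ ≤ R - 3 * s) : ‖deriv (deriv g) w‖ ≤ 25 * Y ^ 2 := by
    refine (norm_deriv_le_of_norm_le hg.deriv hs0 (fun u hu ↦ hA u (by linarith)) hw).trans ?_
    calc 5 * Y / s = 25 * Y * (1 / d) := by rw [hs]; field_simp; ring
      _ ≤ 25 * Y * Y := by gcongr
      _ = _ := by ring
  set L : ℝ := (25 * c + 50) * Y ^ 4 with hL
  have hY24 : Y ^ 2 ≤ Y ^ 4 := pow_le_pow_right₀ hY1 (by norm_num)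
  have hY34 : Y ^ 3 ≤ Y ^ 4 := pow_le_pow_right₀ hY1 (by norm_num)
  have hY14 : 1 ≤ Y ^ 4 := one_le_pow₀ hY1
  have hL1 : 1 ≤ L := by nlinarith
  have hre (w : ℂ) (hw : ‖w‖ ≤ R - 4 * s) :
      (-g w).re ≤ 10 * (R / d) * ((16 + |K|) * Y ^ (1 / 4 : ℝ)) := by
    have hr : 0 < R - 3 * s := by linarith
    have hwr : ‖w‖ < R - 3 * s := by linarith
    have h1 := neg_re_le_of_exp_neg_mul hg hh.deriv hh0 hr hL1
      (fun u hu ↦ (hh' u (by simpa using (mem_sphere_zero_iff_norm.mp hu).le)).trans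
        (by rw [hL]; nlinarith))
      (fun u hu ↦ by
        have hu' : ‖u‖ ≤ R - 3 * s := (mem_sphere_zero_iff_norm.mp hu).le
        rw [exp_neg_mul_deriv_eq hg hh hgh]
        calc ‖deriv h u * deriv g u - deriv (deriv g) u - deriv g u ^ 2‖
            ≤ ‖deriv h u‖ * ‖deriv g u‖ + ‖deriv (deriv g) u‖ + ‖deriv g u‖ ^ 2 := by
              rw [← norm_mul, ← norm_pow]
              exact (norm_sub_le _ _).trans (by gcongr; exact norm_sub_le _ _)
          _ ≤ 5 * c * Y ^ 3 * (5 * Y) + 25 * Y ^ 2 + (5 * Y) ^ 2 := by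
              gcongr
              · exact hh' u hu'
              · exact hA u (by linarith)
              · exact hA' u hu'
              · exact hA u (by linarith)
          _ ≤ L := by rw [hL]; nlinarith)
      hwr
    have hlog : Real.log L - Real.log ‖deriv h 0‖ ≤ (16 + |K|) * Y ^ (1 / 4 : ℝ) := by
      have hQ : 1 ≤ Y ^ (1 / 4 : ℝ) := Real.one_le_rpow hY1 (by norm_num)
      have hlY := Real.log_le_rpow_div (by linarith : 0 ≤ Y) (by norm_num : (0 : ℝ) < 1 / 4)
      rw [hL, Real.log_mul (by positivity) (by positivity), Real.log_pow]
      push_cast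
      nlinarith [le_abs_self K, abs_nonneg K]
    have hfrac : (R - 3 * s + ‖w‖) / (R - 3 * s - ‖w‖) ≤ 10 * (R / d) := by
      calc _ ≤ (2 * R) / s := by gcongr <;> linarith
        _ = _ := by rw [hs]; field_simp; ring
    have hfrac0 : 0 ≤ (R - 3 * s + ‖w‖) / (R - 3 * s - ‖w‖) :=
      div_nonneg (by positivity) (by linarith)
    calc (-g w).re ≤ _ := h1
      _ ≤ (R - 3 * s + ‖w‖) / (R - 3 * s - ‖w‖) * ((16 + |K|) * Y ^ (1 / 4 : ℝ)) := by gcongr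
      _ ≤ _ := by gcongr
  have hQ : 1 ≤ Y ^ (1 / 4 : ℝ) := Real.one_le_rpow hY1 (by norm_num)
  have hQ4 : (Y ^ (1 / 4 : ℝ)) ^ 4 = Y := by
    rw [← Real.rpow_natCast, ← Real.rpow_mul (by positivity)]
    norm_num
  set Q : ℝ := Y ^ (1 / 4 : ℝ)
  have hfin := norm_le_of_re_le hg.neg hs0 (R := R) (by linarith)
    (by positivity : 0 < 10 * (R / d) * ((16 + |K|) * Q)) (fun u hu ↦ hre u (by linarith))
    (hz.trans (by linarith : R - d ≤ R - 5 * s))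
  have hfin' : ‖g z‖ ≤ (100 * (16 + |K|) + 10 * ‖g 0‖) * (R / d) ^ 2 * Q := by
    have hRdQ : 1 ≤ R / d * Q := one_le_mul_of_one_le_of_one_le hRd hQ
    calc ‖g z‖ ≤ (2 * (10 * (R / d) * ((16 + |K|) * Q)) + 2 * ‖g 0‖) * R / s := by
          simpa using hfin
      _ = (20 * (16 + |K|) * (R / d * Q) + 2 * ‖g 0‖ * 1) * 5 * (R / d) := by
          rw [hs]; field_simp; ring
      _ ≤ (20 * (16 + |K|) * (R / d * Q) + 2 * ‖g 0‖ * (R / d * Q)) * 5 * (R / d) := by gcongr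
      _ = _ := by ring
  calc ‖g z‖ ^ 4 ≤ ((100 * (16 + |K|) + 10 * ‖g 0‖) * (R / d) ^ 2 * Q) ^ 4 := by gcongr
    _ = (100 * (16 + |K|) + 10 * ‖g 0‖) ^ 4 * (R / d) ^ 8 * Q ^ 4 := by ring
    _ = _ := by rw [hQ4, hY]; ring

/-- An entire function satisfying a self-improving a priori estimate grows slower than `r`. -/
lemma exists_norm_pow_three_le {g : ℂ → ℂ} (hg : Continuous g) {C : ℝ} (hC0 : 0 ≤ C)
    (hC : ∀ R d M : ℝ, 1 ≤ R → 0 < d → d ≤ R → 1 ≤ M → (∀ w, ‖w‖ ≤ R → ‖g w‖ ≤ M) →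
      ∀ z, ‖z‖ ≤ R - d → ‖g z‖ ^ 4 ≤ C * (R / d) ^ 9 * (M * R)) :
    ∃ C' : ℝ, 0 ≤ C' ∧ ∀ r : ℝ, 1 ≤ r → ∀ z, ‖z‖ ≤ r → ‖g z‖ ^ 3 ≤ C' * r := by
  refine ⟨512 + 2 ^ 22 * C, by positivity, fun r hr z hz ↦ ?_⟩
  have hr0 : 0 < r := by linarith
  obtain ⟨z₀, hz₀, hmax⟩ := (isCompact_closedBall (0 : ℂ) (2 * r)).exists_isMaxOn
    ⟨0, by simpa using hr0.le⟩
    (by fun_prop : Continuous fun w ↦ (2 * r - ‖w‖) ^ 3 * ‖g w‖).continuousOn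
  rw [mem_closedBall_zero_iff] at hz₀
  set S : ℝ := (2 * r - ‖z₀‖) ^ 3 * ‖g z₀‖ with hS
  have hle (w : ℂ) (hw : ‖w‖ ≤ 2 * r) : (2 * r - ‖w‖) ^ 3 * ‖g w‖ ≤ S :=
    hmax (mem_closedBall_zero_iff.mpr hw)
  have hle' (a : ℝ) (ha : 0 ≤ a) (w : ℂ) (hw : ‖w‖ ≤ 2 * r - a) : a ^ 3 * ‖g w‖ ≤ S := by
    refine le_trans ?_ (hle w (by linarith))
    gcongr
    linarith
  have hzS : r ^ 3 * ‖g z‖ ≤ S := hle' r hr0.le z (by linarith)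
  rcases le_or_gt S (8 * r ^ 3) with hS8 | hS8
  · have h8 : ‖g z‖ ≤ 8 := by
      have := hzS.trans hS8
      rw [mul_comm 8] at this
      exact le_of_mul_le_mul_left this (by positivity)
    calc ‖g z‖ ^ 3 ≤ 8 ^ 3 := by gcongr
      _ ≤ (512 + 2 ^ 22 * C) * r := by nlinarith
  · have hS0 : 0 < S := lt_trans (by positivity) hS8
    have hz₀lt : ‖z₀‖ < 2 * r := by
      refine lt_of_le_of_ne hz₀ fun h ↦ hS0.ne' ?_
      rw [hS, h]
      simp
    set d : ℝ := (2 * r - ‖z₀‖) / 2 with hd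
    set R : ℝ := (2 * r + ‖z₀‖) / 2 with hR
    have hn := norm_nonneg z₀
    have hd0 : 0 < d := by linarith
    have hdr : d ≤ r := by linarith
    have hR0 : 0 < R := by linarith
    have hM : 1 ≤ S / d ^ 3 := by
      rw [one_le_div (by positivity)]
      have : d ^ 3 ≤ r ^ 3 := by gcongr
      linarith [pow_pos hr0 3]
    have key := hC R d (S / d ^ 3) (by linarith) hd0 (by linarith) hM
      (fun w hw ↦ by
        rw [le_div_iff₀ (by positivity), mul_comm]
        exact hle' d hd0.le w (by linarith))
      z₀ (by linarith)
    have hg₀ : ‖g z₀‖ = S / (8 * d ^ 3) := by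
      rw [hS, eq_div_iff (by positivity), hd]
      ring
    have hS3 : S ^ 3 ≤ 4096 * C * R ^ 10 := by
      have e1 : ‖g z₀‖ ^ 4 = S ^ 3 * (S / (4096 * d ^ 12)) := by
        rw [hg₀]; field_simp; norm_num
      have e2 : C * (R / d) ^ 9 * (S / d ^ 3 * R) =
          (4096 * C * R ^ 10) * (S / (4096 * d ^ 12)) := by
        field_simp
      rw [e1, e2] at key
      exact le_of_mul_le_mul_right key (by positivity)
    have hfin : r ^ 9 * ‖g z‖ ^ 3 ≤ r ^ 9 * (2 ^ 22 * C * r) := by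
      calc r ^ 9 * ‖g z‖ ^ 3 = (r ^ 3 * ‖g z‖) ^ 3 := by ring
        _ ≤ S ^ 3 := by gcongr
        _ ≤ 4096 * C * R ^ 10 := hS3
        _ ≤ 4096 * C * (2 * r) ^ 10 := by gcongr; linarith
        _ = _ := by ring
    have := le_of_mul_le_mul_left hfin (by positivity)
    linarith

/-- An entire function with `‖g z‖ ^ 3 = O(r)` on the disc of radius `r` has zero derivative. -/
lemma deriv_eq_zero_of_norm_pow_three_le {g : ℂ → ℂ} (hg : Differentiable ℂ g) {C : ℝ}
    (hC0 : 0 ≤ C) (hC : ∀ r : ℝ, 1 ≤ r → ∀ z, ‖z‖ ≤ r → ‖g z‖ ^ 3 ≤ C * r) (z : ℂ) :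
    deriv g z = 0 := by
  by_contra hne
  set D : ℝ := ‖deriv g z‖ with hD
  have hD0 : 0 < D := norm_pos_iff.mpr hne
  set q : ℝ := 16 * C / D ^ 3 with hq
  have hq0 : 0 ≤ q := by positivity
  have hn := norm_nonneg z
  set r : ℝ := 1 + ‖z‖ + q with hr
  have hr1 : 1 ≤ r := by linarith
  have hqC : q * D ^ 3 = 16 * C := by rw [hq]; field_simp
  have hrC : C * (‖z‖ + r) ≤ (D * r / 2) ^ 3 := by
    have h1 : q ≤ r ^ 2 := by nlinarith
    have h2 : 16 * C ≤ r ^ 2 * D ^ 3 := by rw [← hqC]; gcongr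
    calc C * (‖z‖ + r) ≤ C * (2 * r) := by gcongr; linarith
      _ = 16 * C * (r / 8) := by ring
      _ ≤ r ^ 2 * D ^ 3 * (r / 8) := by gcongr
      _ = _ := by ring
  have hbound := norm_deriv_le_of_norm_le hg (by linarith : 0 < r)
    (fun w hw ↦ (pow_le_pow_iff_left₀ (norm_nonneg _) (by positivity) (by norm_num)).mp
      ((hC _ (by linarith) w hw).trans hrC)) le_rfl
  have : D * r / 2 / r = D / 2 := by field_simp
  linarith

/-- If `g' * exp g - 1 = exp h` with `g` and `h` entire, then `g` is constant. -/
lemma deriv_eq_zero_of_deriv_mul_exp_sub_one_eq_exp {g h : ℂ → ℂ} (hg : Differentiable ℂ g)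
    (hh : Differentiable ℂ h)
    (hgh : ∀ z, deriv g z * Complex.exp (g z) - 1 = Complex.exp (h z)) (z : ℂ) :
    deriv g z = 0 := by
  by_cases hh' : ∀ z, deriv h z = 0
  · have hcst (z : ℂ) : deriv g z * Complex.exp (g z) = Complex.exp (h 0) + 1 := by
      rw [← is_const_of_deriv_eq_zero hh hh' z 0, ← hgh z]
      ring
    set c : ℂ := Complex.exp (h 0) + 1
    by_contra hne
    have hc : c ≠ 0 := hcst z ▸ mul_ne_zero hne (Complex.exp_ne_zero _)
    have hlin (x : ℂ) : Complex.exp (g x) - c * x = Complex.exp (g 0) - c * 0 := by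
      have hd (x : ℂ) : HasDerivAt (fun x ↦ Complex.exp (g x) - c * x) 0 x := by
        refine ((hg x).hasDerivAt.cexp.sub ((hasDerivAt_id x).const_mul c)).congr_deriv ?_
        rw [← hcst x]
        ring
      exact is_const_of_deriv_eq_zero (fun x ↦ (hd x).differentiableAt) (fun x ↦ (hd x).deriv) x 0
    apply Complex.exp_ne_zero (g (-Complex.exp (g 0) / c))
    have h := hlin (-Complex.exp (g 0) / c)
    rw [mul_div_cancel₀ _ hc] at h
    linear_combination h
  · push Not at hh'
    obtain ⟨a, ha⟩ := hh'
    have hga : Differentiable ℂ fun z ↦ g (z + a) := by fun_prop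
    obtain ⟨C, hC0, hC⟩ := exists_norm_pow_four_le hga
      (by fun_prop : Differentiable ℂ fun z ↦ h (z + a))
      (fun z ↦ by rw [deriv_comp_add_const]; exact hgh (z + a))
      (by rw [deriv_comp_add_const]; simpa using ha)
    obtain ⟨C', hC'0, hC'⟩ := exists_norm_pow_three_le hga.continuous hC0 hC
    have := deriv_eq_zero_of_norm_pow_three_le hga hC'0 hC' (z - a)
    rwa [deriv_comp_add_const, sub_add_cancel] at this

/-- Polya–Saxer–Millioux with general values: an entire `f` omitting `a`
whose derivative omits `b ≠ 0` must be constant. -/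
theorem polya_saxer_millioux_general (a b : ℂ) (hb : b ≠ 0)
    (f : ℂ → ℂ) (hf : Differentiable ℂ f)
    (ha : ∀ z : ℂ, f z ≠ a) (hb' : ∀ z : ℂ, deriv f z ≠ b) :
    ∃ A : ℂ, ∀ z : ℂ, f z = A := by
  obtain ⟨g, hg, hgf⟩ := exists_differentiable_exp_eq ((hf.sub_const a).div_const b)
    fun z ↦ div_ne_zero (sub_ne_zero.mpr (ha z)) hb
  obtain ⟨h, hh, hhf⟩ := exists_differentiable_exp_eq ((hf.deriv.div_const b).sub_const 1)
    fun z ↦ by simpa [sub_eq_zero, div_eq_one_iff_eq hb] using hb' z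
  have hderiv (z : ℂ) : deriv g z * Complex.exp (g z) = deriv f z / b := by
    have h1 : HasDerivAt (fun z ↦ Complex.exp (g z)) (deriv f z / b) z := by
      rw [funext hgf]
      exact ((hf z).hasDerivAt.sub_const a).div_const b
    rw [mul_comm]
    exact (hg z).hasDerivAt.cexp.unique h1
  have hg' := deriv_eq_zero_of_deriv_mul_exp_sub_one_eq_exp hg hh fun z ↦ by rw [hderiv, hhf]
  refine ⟨f 0, fun z ↦ is_const_of_deriv_eq_zero hf (fun w ↦ ?_) z 0⟩
  have := hderiv w
  rw [hg' w, zero_mul, eq_comm, div_eq_zero_iff] at this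
  exact this.resolve_right hb
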